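/- arXiv:1607.05197 — 9 statements merged into one kernel-verified Lean document; each statement's English description precedes it below -/
import Mathlib

section
/- The prime product number of the complete 3-partite graph K_{1,1,c} equals 1 for all positive integers c if and only if there are infinitely many primes p such that p + 2 is also prime (the Twin Prime Conjecture). -/
/-- `L` is a `k`-prime product distance labeling of `G`: `L` is injective,
labels of distinct vertices differ by more than 1, and for every edge the
absolute difference of labels has at most `k` prime factors counted with
multiplicity. -/
def IsPrimeProductLabeling {V : Type*} (G : SimpleGraph V) (k : ℕ) (L : V → ℤ) : Prop :=
  Function.Injective L ∧
  (∀ u v : V, u ≠ v → 1 < |L u - L v|) ∧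
  (∀ u v : V, G.Adj u v → (L u - L v).natAbs.primeFactorsList.length ≤ k)

/-- `G` is a `k`-prime product graph. -/
def IsPrimeProductGraph {V : Type*} (G : SimpleGraph V) (k : ℕ) : Prop :=
  ∃ L : V → ℤ, IsPrimeProductLabeling G k L

/-- The prime product number of `G`: the least positive `k` such that `G` is a
`k`-prime product graph. -/
noncomputable def ppn {V : Type*} (G : SimpleGraph V) : ℕ :=
  sInf {k : ℕ | 0 < k ∧ IsPrimeProductGraph G k}

/-- The complete 3-partite graph `K_{a,b,c}`. -/
def K3p (a b c : ℕ) : SimpleGraph ((i : Fin 3) × (![Fin a, Fin b, Fin c] i)) :=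
  SimpleGraph.completeMultipartiteGraph ![Fin a, Fin b, Fin c]

theorem Nat.prime_iff_length_primeFactorsList_le_one {n : ℕ} (hn : 1 < n) :
    n.Prime ↔ n.primeFactorsList.length ≤ 1 := by
  rw [← ArithmeticFunction.cardFactors_eq_one_iff_prime, ArithmeticFunction.cardFactors_apply]
  have : n.primeFactorsList ≠ [] := by
    rw [Ne, Nat.primeFactorsList_eq_nil]
    omega
  have := List.length_pos_iff.mpr this
  omega

theorem ppn_eq_one_iff {V : Type*} (G : SimpleGraph V) : ppn G = 1 ↔ IsPrimeProductGraph G 1 := by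
  constructor
  · intro h
    have hne : {k : ℕ | 0 < k ∧ IsPrimeProductGraph G k}.Nonempty :=
      Nat.nonempty_of_pos_sInf (by change 0 < ppn G; omega)
    have := (Nat.sInf_mem hne).2
    change IsPrimeProductGraph G (ppn G) at this
    rwa [h] at this
  · intro h
    have hmem : 1 ∈ {k : ℕ | 0 < k ∧ IsPrimeProductGraph G k} := ⟨one_pos, h⟩
    exact le_antisymm (Nat.sInf_le hmem) (Nat.sInf_mem ⟨1, hmem⟩).1

/-- A 1-prime product labeling of `K_{1,1,c}` amounts to two labels `a`, `b` at prime distance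
and `c` labels, no two of them within distance 1, each at prime distance from both `a` and `b`. -/
theorem isPrimeProductGraph_K3p_one_one_iff (c : ℕ) :
    IsPrimeProductGraph (K3p 1 1 c) 1 ↔ ∃ (a b : ℤ) (x : Fin c → ℤ),
      (a - b).natAbs.Prime ∧ (∀ i, (x i - a).natAbs.Prime ∧ (x i - b).natAbs.Prime) ∧
      ∀ i j, i ≠ j → 1 < |x i - x j| := by
  constructor
  · rintro ⟨L, -, hgap, hadj⟩
    have hprime : ∀ u v, (K3p 1 1 c).Adj u v → (L u - L v).natAbs.Prime := fun u v huv =>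
      (Nat.prime_iff_length_primeFactorsList_le_one
        (by have := hgap u v huv.ne; rw [Int.abs_eq_natAbs] at this; exact_mod_cast this)).mpr
        (hadj u v huv)
    refine ⟨L ⟨0, (0 : Fin 1)⟩, L ⟨1, (0 : Fin 1)⟩, fun i => L ⟨2, i⟩, hprime _ _ ?_,
      fun i => ⟨hprime _ _ ?_, hprime _ _ ?_⟩, fun i j hij => hgap _ _ ?_⟩
    · simp [K3p]
    · simp [K3p]
    · simp [K3p]
    · intro h
      exact hij (eq_of_heq (Sigma.mk.inj h).2)
  · rintro ⟨a, b, x, hab, hx, hgap⟩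
    let L : ((i : Fin 3) × (![Fin 1, Fin 1, Fin c] i)) → ℤ := fun u =>
      match u with
      | ⟨0, _⟩ => a
      | ⟨1, _⟩ => b
      | ⟨2, i⟩ => x i
    have hprime : ∀ u v, (K3p 1 1 c).Adj u v → (L u - L v).natAbs.Prime := by
      have hsymm : ∀ {y z : ℤ}, (y - z).natAbs.Prime → (z - y).natAbs.Prime := by
        intro y z h
        rwa [← Int.natAbs_neg, neg_sub]
      rintro ⟨i, u⟩ ⟨j, v⟩ h
      have hij : i ≠ j := by simpa [K3p] using h
      fin_cases i <;> fin_cases j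
      · exact absurd rfl hij
      · exact hab
      · exact hsymm (hx v).1
      · exact hsymm hab
      · exact absurd rfl hij
      · exact hsymm (hx v).2
      · exact (hx u).1
      · exact (hx u).2
      · exact absurd rfl hij
    have hL : ∀ u v, u ≠ v → 1 < |L u - L v| := by
      rintro ⟨i, u⟩ ⟨j, v⟩ h
      by_cases hij : i = j
      · subst hij
        have huv : u ≠ v := fun e => h (e ▸ rfl)
        fin_cases i
        · exact absurd (Subsingleton.elim (α := Fin 1) u v) huv
        · exact absurd (Subsingleton.elim (α := Fin 1) u v) huv
        · exact hgap u v huv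
      · have := (hprime ⟨i, u⟩ ⟨j, v⟩ (by simpa [K3p] using hij)).one_lt
        rw [Int.abs_eq_natAbs]
        exact_mod_cast this
    refine ⟨L, fun u v huv => ?_, hL, fun u v huv => ?_⟩
    · by_contra h
      have := hL u v h
      simp [huv] at this
    · have := hprime u v huv
      exact (Nat.prime_iff_length_primeFactorsList_le_one this.one_lt).mp this

/-- If all twin primes are at most `N`, then an integer at prime distance from both `a` and `b`
is within `N + 2` of `a` or at distance 2 from `b`. -/
theorem mem_of_natAbs_sub_prime {N : ℕ} (hN : ∀ p : ℕ, p.Prime → (p + 2).Prime → p ≤ N)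
    {a b y : ℤ} (hab : (a - b).natAbs.Prime) (hya : (y - a).natAbs.Prime)
    (hyb : (y - b).natAbs.Prime) :
    y ∈ Finset.Icc (a - (N + 2)) (a + (N + 2)) ∪ {b - 2, b + 2} := by
  simp only [Finset.mem_union, Finset.mem_Icc, Finset.mem_insert, Finset.mem_singleton]
  have h1 := hya.two_le
  have h2 := hyb.two_le
  rcases hab.eq_two_or_odd with hd | hd
  · rcases lt_or_ge (y - a).natAbs (y - b).natAbs with hlt | hle
    · have := hN _ hya (by rwa [show (y - a).natAbs + 2 = (y - b).natAbs by omega])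
      omega
    · have := hN _ hyb (by rwa [show (y - b).natAbs + 2 = (y - a).natAbs by omega])
      omega
  · rcases hya.eq_two_or_odd with ha | ha
    · omega
    · rcases hyb.eq_two_or_odd with hb | hb <;> omega

/-- `ppn (K_{1,1,c}) = 1` for all positive integers `c` if and only if the Twin
Prime Conjecture is true. -/
theorem ppn_K11c_iff_twinPrime :
    (∀ c : ℕ, 0 < c → ppn (K3p 1 1 c) = 1) ↔
      {p : ℕ | p.Prime ∧ (p + 2).Prime}.Infinite := by
  simp only [ppn_eq_one_iff, isPrimeProductGraph_K3p_one_one_iff]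
  constructor
  · intro h hfin
    obtain ⟨N, hN⟩ := hfin.bddAbove
    obtain ⟨a, b, x, hab, hx, hgap⟩ := h (2 * N + 8) (by omega)
    have hinj : Function.Injective x := by
      intro i j hij
      by_contra hne
      have := hgap i j hne
      simp [hij] at this
    have hcard := Finset.card_le_card_of_injOn (s := Finset.univ) x
      (fun i _ => mem_of_natAbs_sub_prime (fun p hp hp' => hN ⟨hp, hp'⟩) hab (hx i).1 (hx i).2)
      hinj.injOn
    have hunion := hcard.trans (Finset.card_union_le _ _)
    have hpair := Finset.card_le_two (a := b - 2) (b := b + 2)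
    rw [Int.card_Icc, Finset.card_univ, Fintype.card_fin] at hunion
    omega
  · intro hinf c _
    have htwin := Nat.nth_mem_of_infinite hinf
    refine ⟨0, -2, fun i => (Nat.nth (fun p => p.Prime ∧ (p + 2).Prime) i : ℤ),
      by norm_num, fun i => ⟨?_, ?_⟩, fun i j hij => ?_⟩
    · simpa using (htwin i).1
    · rw [sub_neg_eq_add]
      exact (htwin i).2
    · have hodd : ∀ p : ℕ, p.Prime ∧ (p + 2).Prime → p % 2 = 1 := by
        rintro p ⟨hp, hp'⟩
        rcases hp.eq_two_or_odd with rfl | h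
        · norm_num at hp'
        · exact h
      have hi := hodd _ (htwin i)
      have hj := hodd _ (htwin j)
      have hne := (Nat.nth_injective hinf).ne (Fin.val_injective.ne hij)
      beta_reduce
      rw [Int.abs_eq_natAbs]
      omega
end

section
/- For positive integers a, b, c, d, the prime product number of the complete 4-partite graph K_{a,b,c,d} equals 1 if and only if a = b = c = d = 1. -/
/-- The complete 4-partite graph `K_{a,b,c,d}`. -/
def K4p (a b c d : ℕ) : SimpleGraph ((i : Fin 4) × (![Fin a, Fin b, Fin c, Fin d] i)) :=
  SimpleGraph.completeMultipartiteGraph ![Fin a, Fin b, Fin c, Fin d]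

theorem Nat.prime_of_length_primeFactorsList_le_one {n : ℕ} (hn : 1 < n)
    (h : n.primeFactorsList.length ≤ 1) : n.Prime := by
  have h0 : n.primeFactorsList.length ≠ 0 := by
    simp only [ne_eq, List.length_eq_zero_iff, Nat.primeFactorsList_eq_nil]
    omega
  obtain ⟨p, hp⟩ := List.length_eq_one_iff.mp (show n.primeFactorsList.length = 1 by omega)
  have hprod := Nat.prod_primeFactorsList (show n ≠ 0 by omega)
  rw [hp, List.prod_singleton] at hprod
  exact hprod ▸ Nat.prime_of_mem_primeFactorsList (n := n) (p := p) (by simp [hp])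

theorem IsPrimeProductLabeling.prime_natAbs_sub {V : Type*} {G : SimpleGraph V} {L : V → ℤ}
    (hL : IsPrimeProductLabeling G 1 L) {u v : V} (h : G.Adj u v) :
    (L u - L v).natAbs.Prime := by
  have h1 := hL.2.1 u v h.ne
  rw [Int.abs_eq_natAbs] at h1
  exact Nat.prime_of_length_primeFactorsList_le_one (by omega) (hL.2.2 u v h)

theorem Nat.Prime.natAbs_small_divisors {z : ℤ} (h : z.natAbs.Prime) :
    (z % 2 = 0 → z = 2 ∨ z = -2) ∧ (z % 3 = 0 → z = 3 ∨ z = -3) ∧ z ≠ 1 ∧ z ≠ -1 ∧ z ≠ 0 := by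
  have h1 := h.one_lt
  refine ⟨fun hz => ?_, fun hz => ?_, by omega, by omega, by omega⟩
  · have := (Nat.prime_dvd_prime_iff_eq Nat.prime_two h).mp (by omega)
    omega
  · have := (Nat.prime_dvd_prime_iff_eq Nat.prime_three h).mp (by omega)
    omega

theorem not_prime_natAbs_arith_prog {w : ℤ} (h0 : w.natAbs.Prime) (h2 : (w + 2).natAbs.Prime)
    (h4 : (w + 4).natAbs.Prime) (h6 : (w + 6).natAbs.Prime) : False := by
  obtain ⟨-, a0, b0⟩ := h0.natAbs_small_divisors
  obtain ⟨-, a2, b2⟩ := h2.natAbs_small_divisors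
  obtain ⟨-, a4, b4⟩ := h4.natAbs_small_divisors
  obtain ⟨-, a6, b6⟩ := h6.natAbs_small_divisors
  rcases show w % 3 = 0 ∨ w % 3 = 1 ∨ w % 3 = 2 by omega with h | h | h
  · have := a0 h
    have := a6 (by omega)
    omega
  · have := a2 (by omega)
    omega
  · have := a4 (by omega)
    omega

/-- A triple of integers at pairwise prime distances, two of which have equal parity, extends in
at most one way to a quadruple at pairwise prime distances. -/
theorem eq_of_prime_distances_of_parity {b c d x y : ℤ} (hcd2 : (c - d) % 2 = 0)
    (hbc : (b - c).natAbs.Prime) (hbd : (b - d).natAbs.Prime) (hcd : (c - d).natAbs.Prime)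
    (hxb : (x - b).natAbs.Prime) (hxc : (x - c).natAbs.Prime) (hxd : (x - d).natAbs.Prime)
    (hyb : (y - b).natAbs.Prime) (hyc : (y - c).natAbs.Prime) (hyd : (y - d).natAbs.Prime) :
    x = y := by
  have odd_of (z : ℤ) (hc : (z - c).natAbs.Prime) (hd : (z - d).natAbs.Prime) :
      (z - c) % 2 = 1 := by
    have h1 := hc.natAbs_small_divisors.1
    have h2 := hd.natAbs_small_divisors.1
    have h3 := hcd.natAbs_small_divisors.1 hcd2
    omega
  have ob := odd_of b hbc hbd
  have ox := odd_of x hxc hxd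
  have oy := odd_of y hyc hyd
  have ex := hxb.natAbs_small_divisors.1 (by omega)
  have ey := hyb.natAbs_small_divisors.1 (by omega)
  have ec := hcd.natAbs_small_divisors.1 hcd2
  rcases ex with ex | ex <;> rcases ey with ey | ey
  · omega
  · rcases ec with ec | ec
    · refine (not_prime_natAbs_arith_prog (w := y - c) ?_ ?_ ?_ ?_).elim <;> grind
    · refine (not_prime_natAbs_arith_prog (w := y - d) ?_ ?_ ?_ ?_).elim <;> grind
  · rcases ec with ec | ec
    · refine (not_prime_natAbs_arith_prog (w := x - c) ?_ ?_ ?_ ?_).elim <;> grind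
    · refine (not_prime_natAbs_arith_prog (w := x - d) ?_ ?_ ?_ ?_).elim <;> grind
  · omega

/-- A triple of integers at pairwise prime distances extends in at most one way to a quadruple at
pairwise prime distances. -/
theorem eq_of_prime_distances {b c d x y : ℤ}
    (hbc : (b - c).natAbs.Prime) (hbd : (b - d).natAbs.Prime) (hcd : (c - d).natAbs.Prime)
    (hxb : (x - b).natAbs.Prime) (hxc : (x - c).natAbs.Prime) (hxd : (x - d).natAbs.Prime)
    (hyb : (y - b).natAbs.Prime) (hyc : (y - c).natAbs.Prime) (hyd : (y - d).natAbs.Prime) :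
    x = y := by
  have hcb : (c - b).natAbs.Prime := by rwa [← Int.natAbs_neg, neg_sub]
  have hdb : (d - b).natAbs.Prime := by rwa [← Int.natAbs_neg, neg_sub]
  have hdc : (d - c).natAbs.Prime := by rwa [← Int.natAbs_neg, neg_sub]
  rcases show (c - d) % 2 = 0 ∨ (b - d) % 2 = 0 ∨ (b - c) % 2 = 0 by omega with h | h | h
  · exact eq_of_prime_distances_of_parity h hbc hbd hcd hxb hxc hxd hyb hyc hyd
  · exact eq_of_prime_distances_of_parity h hcb hcd hbd hxc hxb hxd hyc hyb hyd
  · exact eq_of_prime_distances_of_parity h hdb hdc hbc hxd hxb hxc hyd hyb hyc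

theorem IsPrimeProductGraph.subsingleton_part {V : Fin 4 → Type*} [hV : ∀ i, Nonempty (V i)]
    (h : IsPrimeProductGraph (SimpleGraph.completeMultipartiteGraph V) 1) (i : Fin 4) :
    Subsingleton (V i) := by
  obtain ⟨L, hL⟩ := h
  have f (j : Fin 4) : V j := (hV j).some
  refine ⟨fun p q => ?_⟩
  have key {j k : Fin 4} (hjk : j ≠ k) (u : V j) (v : V k) : (L ⟨j, u⟩ - L ⟨k, v⟩).natAbs.Prime :=
    hL.prime_natAbs_sub hjk
  have shifts_ne : ∀ i : Fin 4, i ≠ i + 1 ∧ i ≠ i + 2 ∧ i ≠ i + 3 ∧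
      i + 1 ≠ i + 2 ∧ i + 1 ≠ i + 3 ∧ i + 2 ≠ i + 3 := by decide
  obtain ⟨h01, h02, h03, h12, h13, h23⟩ := shifts_ne i
  have heq := eq_of_prime_distances (key h12 (f _) (f _)) (key h13 (f _) (f _))
    (key h23 (f _) (f _)) (key h01 p _) (key h02 p _) (key h03 p _) (key h01 q _) (key h02 q _)
    (key h03 q _)
  exact sigma_mk_injective (hL.1 heq)

theorem isPrimeProductGraph_one_of_subsingleton {V : Fin 4 → Type*} [∀ i, Subsingleton (V i)] :
    IsPrimeProductGraph (SimpleGraph.completeMultipartiteGraph V) 1 := by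
  have fst_ne {u v : Σ i, V i} (huv : u ≠ v) : u.1 ≠ v.1 := fun h =>
    huv (Sigma.ext h (Subsingleton.helim (congrArg V h) _ _))
  have gap : ∀ i j : Fin 4, i ≠ j →
      1 < |(![0, 2, 5, 7] : Fin 4 → ℤ) i - (![0, 2, 5, 7] : Fin 4 → ℤ) j| := by decide
  have prime : ∀ i j : Fin 4, i ≠ j →
      ((![0, 2, 5, 7] : Fin 4 → ℤ) i - (![0, 2, 5, 7] : Fin 4 → ℤ) j).natAbs.Prime := by
    intro i j hij
    fin_cases i <;> fin_cases j <;> first | exact absurd rfl hij | norm_num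
  refine ⟨fun v => (![0, 2, 5, 7] : Fin 4 → ℤ) v.1, fun u v huv => ?_, fun u v huv => ?_,
    fun u v huv => ?_⟩
  · by_contra hne
    have := gap _ _ (fst_ne hne)
    simp_all
  · exact gap _ _ (fst_ne huv)
  · rw [Nat.primeFactorsList_prime (prime _ _ huv)]
    simp

/-- For positive integers `a`, `b`, `c`, `d`, we have `ppn (K_{a,b,c,d}) = 1` if
and only if `a = b = c = d = 1`. -/
theorem ppn_K4p (a b c d : ℕ) (ha : 0 < a) (hb : 0 < b) (hc : 0 < c) (hd : 0 < d) :
    ppn (K4p a b c d) = 1 ↔ (a = 1 ∧ b = 1 ∧ c = 1 ∧ d = 1) := by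
  rw [ppn_eq_one_iff, K4p]
  constructor
  · intro h
    have : ∀ i, Nonempty (![Fin a, Fin b, Fin c, Fin d] i) := by
      intro i
      fin_cases i
      exacts [⟨⟨0, ha⟩⟩, ⟨⟨0, hb⟩⟩, ⟨⟨0, hc⟩⟩, ⟨⟨0, hd⟩⟩]
    have h0 : Subsingleton (Fin a) := h.subsingleton_part 0
    have h1 : Subsingleton (Fin b) := h.subsingleton_part 1
    have h2 : Subsingleton (Fin c) := h.subsingleton_part 2
    have h3 : Subsingleton (Fin d) := h.subsingleton_part 3
    rw [Fin.subsingleton_iff_le_one] at h0 h1 h2 h3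
    omega
  · rintro ⟨rfl, rfl, rfl, rfl⟩
    have : ∀ i, Subsingleton (![Fin 1, Fin 1, Fin 1, Fin 1] i) := by
      intro i
      fin_cases i <;> exact inferInstanceAs (Subsingleton (Fin 1))
    exact isPrimeProductGraph_one_of_subsingleton
end

section
/- For a positive integer n, there exists a positive integer k such that the complete graph K_n is a prime kth-power distance graph if and only if n < 7. -/
/-- `L` is a prime `k`th-power distance labeling of `G`: `L` is injective and for
every edge the absolute difference of labels is `p ^ j` for some prime `p` and some
positive integer `j ≤ k`. -/
def IsPrimePowerLabeling {V : Type*} (G : SimpleGraph V) (k : ℕ) (L : V → ℤ) : Prop :=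
  Function.Injective L ∧
  ∀ u v : V, G.Adj u v → ∃ p j : ℕ, p.Prime ∧ 1 ≤ j ∧ j ≤ k ∧ |L u - L v| = (p : ℤ) ^ j

theorem eq_of_two_pow_add_two_pow {a b c : ℕ} (h : (2 : ℤ) ^ a + 2 ^ b = 2 ^ c) : a = b := by
  wlog hab : a ≤ b generalizing a b
  · exact (this (by rw [add_comm, h]) (by omega)).symm
  by_contra hne
  have hlt : (2 : ℤ) ^ a < 2 ^ b := pow_lt_pow_right₀ one_lt_two (by omega)
  have hbc : b < c := by
    refine (pow_lt_pow_iff_right₀ (one_lt_two (α := ℤ))).1 ?_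
    have : (0 : ℤ) < 2 ^ a := by positivity
    omega
  have hle : (2 : ℤ) ^ (b + 1) ≤ 2 ^ c := pow_le_pow_right₀ one_le_two hbc
  rw [pow_succ] at hle
  omega

/-- At most three integers can have all their pairwise differences equal to powers of two. -/
theorem card_le_three_of_sub_eq_two_pow (s : Finset ℤ)
    (hs : ∀ x ∈ s, ∀ y ∈ s, x < y → ∃ j : ℕ, y - x = 2 ^ j) : s.card ≤ 3 := by
  by_contra! hcard
  have hmid : ∀ x ∈ s, ∀ y ∈ s, ∀ z ∈ s, x < y → y < z → y - x = z - y := by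
    intro x hx y hy z hz hxy hyz
    obtain ⟨a, ha⟩ := hs x hx y hy hxy
    obtain ⟨b, hb⟩ := hs y hy z hz hyz
    obtain ⟨c, hc⟩ := hs x hx z hz (hxy.trans hyz)
    rw [ha, hb, eq_of_two_pow_add_two_pow (a := a) (b := b) (c := c) (by omega)]
  obtain ⟨t, hts, ht⟩ := Finset.exists_subset_card_eq (n := 4) hcard
  let e := t.orderEmbOfFin ht
  have he (i : Fin 4) : e i ∈ s := hts (t.orderEmbOfFin_mem ht i)
  have h01 : e 0 < e 1 := e.strictMono (by decide)
  have h12 : e 1 < e 2 := e.strictMono (by decide)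
  have h23 : e 2 < e 3 := e.strictMono (by decide)
  have h1 := hmid _ (he 0) _ (he 1) _ (he 2) h01 h12
  have h2 := hmid _ (he 1) _ (he 2) _ (he 3) h12 h23
  have h3 := hmid _ (he 0) _ (he 2) _ (he 3) (h01.trans h12) h23
  omega

theorem Nat.Prime.eq_two_of_two_dvd_pow {p j : ℕ} (hp : p.Prime) (h : 2 ∣ p ^ j) : p = 2 :=
  ((Nat.prime_dvd_prime_iff_eq Nat.prime_two hp).1 (Nat.prime_two.dvd_of_dvd_pow h)).symm

theorem IsPrimePowerLabeling.card_le_six {V : Type*} [Fintype V] {k : ℕ} {L : V → ℤ}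
    (hL : IsPrimePowerLabeling (⊤ : SimpleGraph V) k L) : Fintype.card V ≤ 6 := by
  classical
  by_contra! hcard
  obtain ⟨r, hr⟩ := Fintype.exists_lt_card_fiber_of_mul_lt_card (n := 3)
    (fun v => (L v : ZMod 2)) (by rw [ZMod.card]; omega)
  set s := (Finset.univ.filter fun v => (L v : ZMod 2) = r).image L with hs
  have hs3 : s.card ≤ 3 := by
    refine card_le_three_of_sub_eq_two_pow s ?_
    simp only [hs, Finset.mem_image, Finset.mem_filter, Finset.mem_univ, true_and]
    rintro _ ⟨u, hu, rfl⟩ _ ⟨v, hv, rfl⟩ huv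
    obtain ⟨p, j, hp, -, -, h⟩ := hL.2 v u (by rintro rfl; exact huv.false)
    rw [abs_of_pos (sub_pos.2 huv)] at h
    have hdvd : ((2 : ℕ) : ℤ) ∣ L v - L u :=
      (ZMod.intCast_eq_intCast_iff_dvd_sub _ _ 2).1 (hu.trans hv.symm)
    rw [h] at hdvd
    obtain rfl := hp.eq_two_of_two_dvd_pow (j := j) (by exact_mod_cast hdvd)
    exact ⟨j, h⟩
  rw [hs, Finset.card_image_of_injective _ hL.1] at hs3
  omega

theorem isPrimePowerLabeling_six :
    IsPrimePowerLabeling (⊤ : SimpleGraph (Fin 6)) 2 ![0, 2, 4, 7, 9, 11] := by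
  have key : ∀ u v : Fin 6, u ≠ v →
      ∃ p ∈ ({2, 3, 5, 7, 11} : Finset ℕ), ∃ j ∈ Finset.Icc 1 2,
        |(![0, 2, 4, 7, 9, 11] : Fin 6 → ℤ) u - (![0, 2, 4, 7, 9, 11] : Fin 6 → ℤ) v|
          = (p : ℤ) ^ j := by
    decide
  refine ⟨by decide, fun u v huv => ?_⟩
  obtain ⟨p, hp, j, hj, h⟩ := key u v huv
  rw [Finset.mem_Icc] at hj
  refine ⟨p, j, ?_, hj.1, hj.2, h⟩
  simp only [Finset.mem_insert, Finset.mem_singleton] at hp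
  rcases hp with rfl | rfl | rfl | rfl | rfl <;> norm_num

theorem IsPrimePowerLabeling.comp_embedding {V W : Type*} {k : ℕ} {L : V → ℤ}
    (hL : IsPrimePowerLabeling (⊤ : SimpleGraph V) k L) (f : W ↪ V) :
    IsPrimePowerLabeling (⊤ : SimpleGraph W) k (L ∘ f) :=
  ⟨hL.1.comp f.injective, fun u v huv => hL.2 (f u) (f v) (f.injective.ne huv)⟩

/-- There exists a positive integer `k` such that `K_n` is a prime `k`th-power
distance graph if and only if `n < 7`. -/
theorem completeGraph_primePower_iff (n : ℕ) (hn : 0 < n) :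
    (∃ k : ℕ, 0 < k ∧ ∃ L : Fin n → ℤ, IsPrimePowerLabeling (⊤ : SimpleGraph (Fin n)) k L)
      ↔ n < 7 := by
  constructor
  · rintro ⟨k, -, L, hL⟩
    have := hL.card_le_six
    rw [Fintype.card_fin] at this
    omega
  · intro h
    exact ⟨2, two_pos, _, isPrimePowerLabeling_six.comp_embedding
      (Fin.castLEEmb (Nat.le_of_lt_succ h))⟩
end

section
/- For every integer k ≥ 2, the cycle C₃ (equivalently, the complete graph K₃) is not a strict prime kth-power distance graph. -/
/-- `L` is a strict prime `k`th-power distance labeling of `G`: `L` is injective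
and for every edge the absolute difference of labels is the `k`th power of a prime. -/
def IsStrictPrimePowerLabeling {V : Type*} (G : SimpleGraph V) (k : ℕ) (L : V → ℤ) : Prop :=
  Function.Injective L ∧
  ∀ u v : V, G.Adj u v → ∃ p : ℕ, p.Prime ∧ |L u - L v| = (p : ℤ) ^ k

lemma Nat.pow_add_pow_lt_add_pow {a b k : ℕ} (ha : 0 < a) (hb : 0 < b) (hk : 2 ≤ k) :
    a ^ k + b ^ k < (a + b) ^ k := by
  obtain ⟨m, rfl⟩ : ∃ m, k = m + 1 := ⟨k - 1, by omega⟩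
  have h₁ : a ^ m < (a + b) ^ m := Nat.pow_lt_pow_left (by omega) (by omega)
  have h₂ : b ^ m < (a + b) ^ m := Nat.pow_lt_pow_left (by omega) (by omega)
  simp only [pow_succ]
  nlinarith

lemma Nat.Prime.two_pow_add_pow_ne_pow {q r k : ℕ} (hq : q.Prime) (hr : r.Prime)
    (hk : 2 ≤ k) (hq_odd : Odd q) : 2 ^ k + q ^ k ≠ r ^ k := by
  intro h
  have hqr : q < r := lt_of_pow_lt_pow_left' k (by have := Nat.two_pow_pos k; omega)
  have hr_odd : Odd r := hr.odd_of_ne_two (by have := hq.two_le; omega)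
  have hle : 2 + q ≤ r := by
    obtain ⟨a, rfl⟩ := hq_odd
    obtain ⟨b, rfl⟩ := hr_odd
    omega
  exact absurd h (((Nat.pow_add_pow_lt_add_pow two_pos hq.pos hk).trans_le
    (Nat.pow_le_pow_left hle k)).ne)

/-- Fermat's Last Theorem for prime bases. -/
lemma Nat.Prime.pow_add_pow_ne_pow {p q r k : ℕ} (hp : p.Prime) (hq : q.Prime)
    (hr : r.Prime) (hk : 2 ≤ k) : p ^ k + q ^ k ≠ r ^ k := by
  intro h
  have hk₀ : k ≠ 0 := by omega
  have hpr : p < r := lt_of_pow_lt_pow_left' k (by have := Nat.pow_pos hq.pos (n := k); omega)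
  have hr_odd : Odd (r ^ k) := (hr.odd_of_ne_two (by have := hp.two_le; omega)).pow
  rw [← h, Nat.odd_add, Nat.odd_pow_iff hk₀, Nat.even_pow' hk₀] at hr_odd
  rcases hq.eq_two_or_odd' with rfl | hq_odd
  · exact hp.two_pow_add_pow_ne_pow hr hk (hr_odd.2 even_two) (add_comm (2 ^ k) _ ▸ h)
  · obtain rfl : p = 2 := hp.eq_two_or_odd'.resolve_right
      fun hp_odd => Nat.not_even_iff_odd.2 hq_odd (hr_odd.1 hp_odd)
    exact hq.two_pow_add_pow_ne_pow hr hk hq_odd h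

/-- The cycle `C₃` is not a strict prime `k`th-power distance graph for any `k ≥ 2`. -/
theorem C3_not_strictPrimePower (k : ℕ) (hk : 2 ≤ k) :
    ¬ ∃ L : Fin 3 → ℤ, IsStrictPrimePowerLabeling (SimpleGraph.cycleGraph 3) k L := by
  rintro ⟨L, -, hL⟩
  obtain ⟨p, hp, h₁⟩ := hL 0 1 (by simp [SimpleGraph.cycleGraph_three_eq_top])
  obtain ⟨q, hq, h₂⟩ := hL 1 2 (by simp [SimpleGraph.cycleGraph_three_eq_top])
  obtain ⟨r, hr, h₃⟩ := hL 0 2 (by simp [SimpleGraph.cycleGraph_three_eq_top])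
  have H₁ := hp.pow_add_pow_ne_pow hq hr hk
  have H₂ := hp.pow_add_pow_ne_pow hr hq hk
  have H₃ := hq.pow_add_pow_ne_pow hr hp hk
  zify at H₁ H₂ H₃
  rw [← h₁, ← h₂, ← h₃] at H₁ H₂ H₃
  grind
end

section
/- For all positive integers k and n with n ≥ 2, the even cycle C_{2n} is a strict prime kth-power distance graph; moreover, for every integer M there is a strict prime kth-power distance labeling of C_{2n} in which for every edge uv the difference |L(u) − L(v)| exceeds M. -/
/-- There is a superincreasing sequence of `k`th powers of primes exceeding `B`, given here
by its partial sums `s`. -/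
lemma exists_partialSums_prime_pow (k : ℕ) (hk : 0 < k) (B : ℕ) :
    ∃ s : ℕ → ℕ, s 0 = 0 ∧
      ∀ i, ∃ p : ℕ, p.Prime ∧ s (i + 1) = s i + p ^ k ∧ s i + B < p ^ k := by
  choose p hle hp using Nat.exists_infinite_primes
  refine ⟨fun i => Nat.rec 0 (fun _ x => x + p (x + B + 1) ^ k) i, rfl,
    fun i => ⟨_, hp _, rfl, ?_⟩⟩
  exact (Nat.lt_of_succ_le (hle _)).trans_le (Nat.le_self_pow hk.ne' _)

/-- Adjacent vertices of a cycle graph have consecutive indices, or are its two end indices. -/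
lemma val_of_cycleGraph_adj {m : ℕ} {u v : Fin m} (h : (SimpleGraph.cycleGraph m).Adj u v) :
    (v.val = u.val + 1 ∨ u.val + 1 = m ∧ v.val = 0) ∨
      (u.val = v.val + 1 ∨ v.val + 1 = m ∧ u.val = 0) := by
  have hsub : ∀ a b : Fin m, (a - b).val = 1 →
      a.val = b.val + 1 ∨ b.val + 1 = m ∧ a.val = 0 := by
    intro a b hab
    have ha := a.isLt
    have hb := b.isLt
    rcases le_or_gt b a with hle | hlt
    · rw [Fin.sub_val_of_le hle] at hab
      omega
    · rw [Fin.coe_sub_iff_lt.2 hlt] at hab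
      have := Fin.lt_def.1 hlt
      omega
  rw [SimpleGraph.cycleGraph_adj'] at h
  rcases h with h | h
  · exact Or.inr (hsub u v h)
  · exact Or.inl (hsub v u h)

/-- For all positive integers `k` and `n ≥ 2`, the even cycle `C_{2n}` is a strict
prime `k`th-power distance graph, and the edge differences in the labeling may be
chosen arbitrarily large. -/
theorem evenCycle_strictPrimePower (k n : ℕ) (hk : 0 < k) (hn : 2 ≤ n) (M : ℤ) :
    ∃ L : Fin (2 * n) → ℤ,
      IsStrictPrimePowerLabeling (SimpleGraph.cycleGraph (2 * n)) k L ∧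
      ∀ u v : Fin (2 * n), (SimpleGraph.cycleGraph (2 * n)).Adj u v → M < |L u - L v| := by
  obtain ⟨s, hs0, hs⟩ := exists_partialSums_prime_pow k hk M.toNat
  have hmono : StrictMono s := strictMono_nat_of_lt_succ fun i => by
    obtain ⟨p, -, h1, h2⟩ := hs i
    omega
  let f : ℕ → ℤ := fun i => if i < n then s i else s n - s (i - n)
  have hstep : ∀ i j : ℕ, i < 2 * n → (j < 2 * n ∧ j = i + 1 ∨ i + 1 = 2 * n ∧ j = 0) →
      ∃ p : ℕ, p.Prime ∧ |f i - f j| = (p : ℤ) ^ k ∧ M < (p : ℤ) ^ k := by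
    intro i j hi hij
    obtain ⟨l, hl⟩ : ∃ l, |f i - f j| = |(s (l + 1) : ℤ) - s l| := by
      rcases hij with ⟨hj, rfl⟩ | ⟨hi', rfl⟩
      · rcases lt_trichotomy (i + 1) n with h | h | h
        · refine ⟨i, ?_⟩
          simp only [f, h, (Nat.lt_succ_self i).trans h, if_true]
          exact abs_sub_comm _ _
        · refine ⟨i, ?_⟩
          subst h
          simp only [f, Nat.lt_succ_self, lt_irrefl, if_true, if_false, Nat.sub_self, hs0,
            Nat.cast_zero, sub_zero]
          exact abs_sub_comm _ _
        · refine ⟨i - n, ?_⟩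
          have h1 : ¬ i < n := by omega
          have h2 : ¬ i + 1 < n := by omega
          have h3 : i + 1 - n = i - n + 1 := by omega
          simp only [f, h1, h2, h3, if_false]
          congr 1
          ring
      · refine ⟨i - n, ?_⟩
        have h1 : ¬ i < n := by omega
        have h2 : 0 < n := by omega
        have h3 : i - n + 1 = n := by omega
        simp [f, h1, h2, h3, hs0]
    obtain ⟨p, hp, h1, h2⟩ := hs l
    refine ⟨p, hp, ?_, ?_⟩
    · rw [hl, h1]
      push_cast
      rw [add_sub_cancel_left, abs_of_nonneg (by positivity)]
    · rw [← Nat.cast_pow]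
      omega
  have hedge : ∀ u v : Fin (2 * n), (SimpleGraph.cycleGraph (2 * n)).Adj u v →
      ∃ p : ℕ, p.Prime ∧ |f u - f v| = (p : ℤ) ^ k ∧ M < (p : ℤ) ^ k := by
    intro u v huv
    have hu := u.isLt
    have hv := v.isLt
    rcases val_of_cycleGraph_adj huv with h | h
    · exact hstep u v hu (by omega)
    · rw [abs_sub_comm]
      exact hstep v u hv (by omega)
  refine ⟨fun i => f i, ⟨?_, fun u v huv => ?_⟩, fun u v huv => ?_⟩
  · have hgap : ∀ i j : ℕ, i < n → j < n → s i + s j < s n := by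
      intro i j hi hj
      obtain ⟨p, -, h1, h2⟩ := hs (n - 1)
      rw [show n - 1 + 1 = n by omega] at h1
      have hi' := hmono.monotone (show i ≤ n - 1 by omega)
      have hj' := hmono.monotone (show j ≤ n - 1 by omega)
      omega
    intro u v huv
    have hu := u.isLt
    have hv := v.isLt
    apply Fin.ext
    simp only [f] at huv
    split_ifs at huv with h1 h2 h2
    · exact hmono.injective (by omega)
    · have := hgap u (v - n) h1 (by omega)
      omega
    · have := hgap v (u - n) h2 (by omega)
      omega
    · have : u.val - n = v.val - n := hmono.injective (by omega)
      omega
  · obtain ⟨p, hp, h, -⟩ := hedge u v huv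
    exact ⟨p, hp, h⟩
  · obtain ⟨p, -, h, hM⟩ := hedge u v huv
    exact h ▸ hM
end

section
/- For positive integers k and n, if the odd cycle C_{2n+1} is a strict prime kth-power distance graph, then for every integer j ≥ 1 the odd cycle C_{2(n+j)+1} is also a strict prime kth-power distance graph. -/
/-- A strict prime `k`th-power labeling of a cycle, with the vertices listed as `0, …, m - 1`. -/
theorem exists_isStrictPrimePowerLabeling_cycleGraph_iff (k m : ℕ) (hm : 2 ≤ m) :
    (∃ L : Fin m → ℤ, IsStrictPrimePowerLabeling (SimpleGraph.cycleGraph m) k L) ↔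
      ∃ f : ℕ → ℤ, (∀ a < m, ∀ b < m, f a = f b → a = b) ∧
        (∀ i, i + 1 < m → ∃ p : ℕ, p.Prime ∧ |f (i + 1) - f i| = (p : ℤ) ^ k) ∧
        ∃ p : ℕ, p.Prime ∧ |f 0 - f (m - 1)| = (p : ℤ) ^ k := by
  constructor
  · rintro ⟨L, hinj, hL⟩
    refine ⟨fun i => if h : i < m then L ⟨i, h⟩ else 0, ?_, ?_, ?_⟩
    · intro a ha b hb hab
      simpa using hinj (by simpa [ha, hb] using hab : L ⟨a, ha⟩ = L ⟨b, hb⟩)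
    · intro i hi
      have hi' : i < m := by omega
      have hadj : (SimpleGraph.cycleGraph m).Adj ⟨i + 1, hi⟩ ⟨i, hi'⟩ := by
        rw [SimpleGraph.cycleGraph_adj']
        left
        rw [Fin.coe_sub_iff_le.2 (by simp)]
        simp
      simpa [hi, hi'] using hL _ _ hadj
    · have h0 : 0 < m := by omega
      have h1 : m - 1 < m := by omega
      have hadj : (SimpleGraph.cycleGraph m).Adj ⟨0, h0⟩ ⟨m - 1, h1⟩ := by
        rw [SimpleGraph.cycleGraph_adj']
        left
        rw [Fin.coe_sub_iff_lt.2 (by simp [Fin.lt_def]; omega)]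
        simp only
        omega
      simpa [h0, h1] using hL _ _ hadj
  · rintro ⟨f, hinj, hstep, hclose⟩
    refine ⟨fun i => f i, fun a b hab => Fin.ext (hinj a a.2 b b.2 hab), ?_⟩
    have key : ∀ u v : Fin m, (u - v).val = 1 →
        ∃ p : ℕ, p.Prime ∧ |f u - f v| = (p : ℤ) ^ k := by
      intro u v huv
      rcases le_or_gt v u with h | h
      · rw [Fin.coe_sub_iff_le.2 h] at huv
        have hu : u.val = v.val + 1 := by omega
        rw [hu]
        exact hstep v (hu ▸ u.2)
      · rw [Fin.coe_sub_iff_lt.2 h] at huv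
        have hu : u.val = 0 := by omega
        have hv : v.val = m - 1 := by omega
        rw [hu, hv]
        exact hclose
    intro u v huv
    rcases SimpleGraph.cycleGraph_adj'.1 huv with h | h
    · exact key u v h
    · simpa only [abs_sub_comm] using key v u h

/-- Replacing an edge `ab` of a labeled cycle by the path `a, a + p ^ k, b + p ^ k, b`
for a large prime `p` lengthens the cycle by two. -/
theorem IsStrictPrimePowerLabeling.exists_cycleGraph_add_two (k m : ℕ) (hk : 0 < k) (hm : 2 ≤ m)
    (h : ∃ L : Fin m → ℤ, IsStrictPrimePowerLabeling (SimpleGraph.cycleGraph m) k L) :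
    ∃ L : Fin (m + 2) → ℤ, IsStrictPrimePowerLabeling (SimpleGraph.cycleGraph (m + 2)) k L := by
  rw [exists_isStrictPrimePowerLabeling_cycleGraph_iff k _ (by omega)] at h ⊢
  obtain ⟨f, hinj, hstep, hclose⟩ := h
  obtain ⟨P, hP, hPf⟩ : ∃ P : ℤ, (∃ p : ℕ, p.Prime ∧ P = (p : ℤ) ^ k) ∧
      ∀ a < m, ∀ b < m, f a < f b + P := by
    obtain ⟨p, hp, hpp⟩ := Nat.exists_infinite_primes (2 * (∑ i ∈ Finset.range m, (f i).natAbs) + 1)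
    refine ⟨(p : ℤ) ^ k, ⟨p, hpp, rfl⟩, fun a ha b hb => ?_⟩
    have hle : ∀ i < m, (f i).natAbs ≤ ∑ i ∈ Finset.range m, (f i).natAbs := fun i hi =>
      Finset.single_le_sum (f := fun i => (f i).natAbs) (fun _ _ => Nat.zero_le _)
        (Finset.mem_range.2 hi)
    have hpk : (p : ℤ) ≤ (p : ℤ) ^ k := by exact_mod_cast Nat.le_self_pow hk.ne' p
    have := hle a ha
    have := hle b hb
    omega
  have hP0 : |P| = P := abs_of_pos (by have := hPf 0 (by omega) 0 (by omega); omega)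
  let g : ℕ → ℤ := fun i => if i < m then f i else if i = m then f (m - 1) + P else f 0 + P
  have g1 : ∀ i < m, g i = f i := fun i hi => if_pos hi
  have g2 : g m = f (m - 1) + P := by simp [g]
  have g3 : g (m + 1) = f 0 + P := by simp [g]
  have hne : f (m - 1) ≠ f 0 := fun h => by
    have := hinj _ (by omega) _ (by omega) h
    omega
  refine ⟨g, ?_, ?_, ?_⟩
  · have hlt : ∀ a < m, f a < f (m - 1) + P ∧ f a < f 0 + P := fun a ha =>
      ⟨hPf a ha _ (by omega), hPf a ha _ (by omega)⟩
    have hcases : ∀ a < m + 2, a < m ∨ a = m ∨ a = m + 1 := by omega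
    intro a ha b hb hab
    rcases hcases a ha with ha | rfl | rfl <;> rcases hcases b hb with hb | rfl | rfl
    · rw [g1 a ha, g1 b hb] at hab
      exact hinj a ha b hb hab
    all_goals grind
  · intro i hi
    obtain hi | hi | hi : i + 1 < m ∨ i + 1 = m ∨ i = m := by omega
    · rw [g1 _ hi, g1 _ (by omega)]
      exact hstep i hi
    · have hi' : i = m - 1 := by omega
      rw [hi, g2, g1 i (by omega), hi', add_sub_cancel_left, hP0]
      exact hP
    · rw [hi, g3, g2, add_sub_add_right_eq_sub]
      exact hclose
  · rw [show m + 2 - 1 = m + 1 by omega, g3, g1 0 (by omega), sub_add_cancel_left, abs_neg, hP0]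
    exact hP

/-- If the odd cycle `C_{2n+1}` is a strict prime `k`th-power distance graph, then so is
every larger odd cycle `C_{2(n+j)+1}` for `j ≥ 1`. -/
theorem oddCycle_strictPrimePower_step (k n : ℕ) (hk : 0 < k) (hn : 0 < n)
    (h : ∃ L : Fin (2 * n + 1) → ℤ,
      IsStrictPrimePowerLabeling (SimpleGraph.cycleGraph (2 * n + 1)) k L)
    (j : ℕ) (hj : 1 ≤ j) :
    ∃ L : Fin (2 * (n + j) + 1) → ℤ,
      IsStrictPrimePowerLabeling (SimpleGraph.cycleGraph (2 * (n + j) + 1)) k L := by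
  clear hj
  induction j with
  | zero => exact h
  | succ j ih =>
    exact IsStrictPrimePowerLabeling.exists_cycleGraph_add_two k (2 * (n + j) + 1) hk (by omega) ih
end

section
/- For positive integers k and n with 2n+1 ≥ 3, if the odd cycle C_{2n+1} is a strict prime kth-power distance graph, then for every integer m > 2n+1 the cycle C_m is a strict prime kth-power distance graph. -/
/-- The absolute difference of `a` and `b` is the `k`th power of a prime. -/
def IsPrimePowerDist (k : ℕ) (a b : ℤ) : Prop :=
  ∃ p : ℕ, p.Prime ∧ |a - b| = (p : ℤ) ^ k

/-- The first `m` values of `f` label the vertices of a cycle of length `m` in cyclic order. -/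
structure IsCyclicLabeling (k m : ℕ) (f : ℕ → ℤ) : Prop where
  injOn : ∀ i < m, ∀ j < m, f i = f j → i = j
  step : ∀ i, i + 1 < m → IsPrimePowerDist k (f i) (f (i + 1))
  last : IsPrimePowerDist k (f (m - 1)) (f 0)

theorem IsPrimePowerDist.symm {k : ℕ} {a b : ℤ} (h : IsPrimePowerDist k a b) :
    IsPrimePowerDist k b a := by
  obtain ⟨p, hp, h⟩ := h
  exact ⟨p, hp, by rw [abs_sub_comm, h]⟩

theorem cycleGraph_adj_of_val_succ {m : ℕ} {u v : Fin m} (h : u.val + 1 = v.val) :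
    (SimpleGraph.cycleGraph m).Adj u v := by
  rw [SimpleGraph.cycleGraph_adj']
  right
  rw [Fin.sub_val_of_le (Fin.le_def.2 (by omega))]
  omega

theorem cycleGraph_adj_last_zero {m : ℕ} (hm : 2 ≤ m) {u v : Fin m} (hu : u.val = m - 1)
    (hv : v.val = 0) : (SimpleGraph.cycleGraph m).Adj u v := by
  rw [SimpleGraph.cycleGraph_adj']
  right
  simp only [Fin.sub_def, hu, hv]
  rw [Nat.mod_eq_of_lt] <;> omega

theorem val_sub_eq_one {m : ℕ} {u v : Fin m} (h : (v - u).val = 1) :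
    u.val + 1 = v.val ∨ (u.val = m - 1 ∧ v.val = 0) := by
  have hu := u.isLt
  have hv := v.isLt
  rcases le_or_gt u v with huv | huv
  · rw [Fin.sub_val_of_le huv] at h
    omega
  · rw [Fin.lt_def] at huv
    rw [Fin.sub_def] at h
    simp only at h
    rw [Nat.mod_eq_of_lt (by omega)] at h
    omega

theorem exists_isCyclicLabeling_iff {k m : ℕ} (hm : 2 ≤ m) :
    (∃ f, IsCyclicLabeling k m f) ↔
      ∃ L : Fin m → ℤ, IsStrictPrimePowerLabeling (SimpleGraph.cycleGraph m) k L := by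
  constructor
  · rintro ⟨f, hf⟩
    have key : ∀ u v : Fin m, (v - u).val = 1 → IsPrimePowerDist k (f u) (f v) := by
      intro u v h
      rcases val_sub_eq_one h with h | ⟨hu, hv⟩
      · rw [← h]
        exact hf.step u (h ▸ v.isLt)
      · rw [hu, hv]
        exact hf.last
    refine ⟨fun i => f i, fun i j hij => Fin.ext (hf.injOn i i.isLt j j.isLt hij), ?_⟩
    intro u v huv
    rw [SimpleGraph.cycleGraph_adj'] at huv
    exact huv.elim (fun h => (key v u h).symm) (key u v)
  · rintro ⟨L, hinj, hL⟩
    refine ⟨fun i => if h : i < m then L ⟨i, h⟩ else 0, ?_, ?_, ?_⟩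
    · intro i hi j hj hij
      simp only [hi, hj, dif_pos] at hij
      exact Fin.mk.inj_iff.1 (hinj hij)
    · intro i hi
      simp only [hi, (Nat.lt_succ_self i).trans hi, dif_pos]
      exact hL _ _ (cycleGraph_adj_of_val_succ rfl)
    · have h0 : 0 < m := by omega
      have h1 : m - 1 < m := by omega
      simp only [h0, h1, dif_pos]
      exact hL _ _ (cycleGraph_adj_last_zero hm rfl rfl)

/-- The closing edge of a labeled cycle can be replaced by a path of three edges whose two outer
differences are the same large prime power. -/
theorem IsCyclicLabeling.exists_add_two {k m : ℕ} (hk : 0 < k) (hm : 2 ≤ m) {f : ℕ → ℤ}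
    (hf : IsCyclicLabeling k m f) : ∃ g, IsCyclicLabeling k (m + 2) g := by
  obtain ⟨B, hB⟩ : ∃ B : ℕ, ∀ i < m, |f i| ≤ B := by
    refine ⟨∑ i ∈ Finset.range m, (f i).natAbs, fun i hi => ?_⟩
    rw [Int.abs_eq_natAbs]
    exact_mod_cast Finset.single_le_sum (f := fun i => (f i).natAbs)
      (fun _ _ => Nat.zero_le _) (Finset.mem_range.2 hi)
  obtain ⟨q, hqB, hq⟩ := Nat.exists_infinite_primes (2 * B + 1)
  have hqk : (2 * B + 1 : ℤ) ≤ (q : ℤ) ^ k := by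
    exact_mod_cast hqB.trans (Nat.le_self_pow hk.ne' q)
  have hfar : ∀ i < m, ∀ j < m, f i ≠ f j + (q : ℤ) ^ k := by
    intro i hi j hj h
    have h1 := abs_le.1 (hB i hi)
    have h2 := abs_le.1 (hB j hj)
    linarith [h1.2, h2.1]
  have hne : f (m - 1) ≠ f 0 := fun h => by
    have := hf.injOn (m - 1) (by omega) 0 (by omega) h
    omega
  have habs : |(q : ℤ) ^ k| = (q : ℤ) ^ k := abs_of_nonneg (by positivity)
  let g : ℕ → ℤ := fun i =>
    if i < m then f i else if i = m then f (m - 1) + (q : ℤ) ^ k else f 0 + (q : ℤ) ^ k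
  have g_lt : ∀ i < m, g i = f i := fun i hi => if_pos hi
  have g_m : g m = f (m - 1) + (q : ℤ) ^ k := by simp [g]
  have g_succ : g (m + 1) = f 0 + (q : ℤ) ^ k := by simp [g]
  refine ⟨g, ?_, ?_, ?_⟩
  · have split : ∀ i < m + 2, i < m ∨ i = m ∨ i = m + 1 := by omega
    intro i hi j hj hij
    rcases split i hi with hi | rfl | rfl <;> rcases split j hj with hj | rfl | rfl
    · rw [g_lt i hi, g_lt j hj] at hij
      exact hf.injOn i hi j hj hij
    · rw [g_lt i hi, g_m] at hij
      exact absurd hij (hfar _ hi _ (by omega))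
    · rw [g_lt i hi, g_succ] at hij
      exact absurd hij (hfar _ hi _ (by omega))
    · rw [g_lt j hj, g_m] at hij
      exact absurd hij.symm (hfar _ hj _ (by omega))
    · rfl
    · rw [g_m, g_succ] at hij
      exact absurd (add_right_cancel hij) hne
    · rw [g_lt j hj, g_succ] at hij
      exact absurd hij.symm (hfar _ hj _ (by omega))
    · rw [g_m, g_succ] at hij
      exact absurd (add_right_cancel hij).symm hne
    · rfl
  · intro i hi
    obtain h | h | rfl : i + 1 < m ∨ i + 1 = m ∨ i = m := by omega
    · rw [g_lt i (by omega), g_lt _ h]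
      exact hf.step i h
    · rw [h, g_lt i (by omega), g_m, ← h]
      exact ⟨q, hq, by simp⟩
    · rw [g_m, g_succ]
      obtain ⟨p, hp, h⟩ := hf.last
      exact ⟨p, hp, by rw [add_sub_add_right_eq_sub, h]⟩
  · rw [show m + 2 - 1 = m + 1 by omega, g_succ, g_lt 0 (by omega)]
    exact ⟨q, hq, by simp⟩

theorem IsCyclicLabeling.exists_add_two_mul {k m : ℕ} (hk : 0 < k) (hm : 2 ≤ m)
    (h : ∃ f, IsCyclicLabeling k m f) (j : ℕ) : ∃ g, IsCyclicLabeling k (m + 2 * j) g := by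
  induction j with
  | zero => exact h
  | succ j ih =>
    obtain ⟨f, hf⟩ := ih
    exact hf.exists_add_two hk (hm.trans (Nat.le_add_right m (2 * j)))

theorem exists_isCyclicLabeling_two (k : ℕ) : ∃ f, IsCyclicLabeling k 2 f := by
  refine ⟨fun i => i * 2 ^ k, ?_, ?_, ?_⟩
  · intro i _ j _ hij
    exact_mod_cast mul_right_cancel₀ (pow_ne_zero k (two_ne_zero' ℤ)) hij
  · intro i _
    refine ⟨2, Nat.prime_two, ?_⟩
    rw [← sub_mul]
    simp
  · exact ⟨2, Nat.prime_two, by simp⟩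


/-- If an odd cycle `C_{2n+1}` (with `2n+1 ≥ 3`) is a strict prime `k`th-power distance
graph, then so is every larger cycle `C_m`. -/
theorem oddCycle_strictPrimePower_larger (k n : ℕ) (hk : 0 < k) (hn : 0 < n)
    (h3 : 3 ≤ 2 * n + 1)
    (h : ∃ L : Fin (2 * n + 1) → ℤ,
      IsStrictPrimePowerLabeling (SimpleGraph.cycleGraph (2 * n + 1)) k L)
    (m : ℕ) (hm : 2 * n + 1 < m) :
    ∃ L : Fin m → ℤ, IsStrictPrimePowerLabeling (SimpleGraph.cycleGraph m) k L := by
  rw [← exists_isCyclicLabeling_iff (by omega)] at h ⊢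
  obtain ⟨j, rfl | rfl⟩ : ∃ j, m = 2 + 2 * j ∨ m = 2 * n + 1 + 2 * j := by
    rcases Nat.even_or_odd' m with ⟨c, rfl | rfl⟩
    · exact ⟨c - 1, by omega⟩
    · exact ⟨c - n, by omega⟩
  · exact IsCyclicLabeling.exists_add_two_mul hk le_rfl (exists_isCyclicLabeling_two k) j
  · exact IsCyclicLabeling.exists_add_two_mul hk (by omega) h j
end

section
/- For every integer k ≥ 1, there exists an odd integer N ≥ 3 such that the cycle C_N is a strict prime kth-power distance graph. -/
/-- A closed walk on the integers of length `a + b`: `b` steps of `+a`, followed by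
`a` steps of `-b`. -/
def twoStepLabel (a b i : ℕ) : ℤ :=
  if i ≤ b then (i : ℤ) * a else ((a : ℤ) + b - i) * b

theorem twoStepLabel_ne_of_le_of_lt {a b i j : ℕ} (hab : a.Coprime b)
    (hi : i ≤ b) (hbj : b < j) (hj : j < a + b) :
    twoStepLabel a b i ≠ twoStepLabel a b j := by
  intro h
  rw [twoStepLabel, twoStepLabel, if_pos hi, if_neg hbj.not_ge] at h
  have hdvd : a ∣ a + b - j := by
    refine hab.dvd_of_dvd_mul_right ⟨i, ?_⟩
    zify [hj.le]
    linarith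
  have := Nat.le_of_dvd (by omega) hdvd
  omega

theorem twoStepLabel_injOn {a b : ℕ} (ha : 0 < a) (hb : 0 < b) (hab : a.Coprime b) :
    Set.InjOn (twoStepLabel a b) (Set.Iio (a + b)) := by
  intro i hi j hj h
  rw [Set.mem_Iio] at hi hj
  rcases le_or_gt i b with hib | hib <;> rcases le_or_gt j b with hjb | hjb
  · have ha' : (a : ℤ) ≠ 0 := by exact_mod_cast ha.ne'
    rw [twoStepLabel, twoStepLabel, if_pos hib, if_pos hjb] at h
    exact_mod_cast mul_right_cancel₀ ha' h
  · exact absurd h (twoStepLabel_ne_of_le_of_lt hab hib hjb hj)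
  · exact absurd h.symm (twoStepLabel_ne_of_le_of_lt hab hjb hib hi)
  · have hb' : (b : ℤ) ≠ 0 := by exact_mod_cast hb.ne'
    rw [twoStepLabel, twoStepLabel, if_neg hib.not_ge, if_neg hjb.not_ge] at h
    have := mul_right_cancel₀ hb' h
    omega

theorem abs_twoStepLabel_sub_succ (a b i : ℕ) :
    |twoStepLabel a b (i + 1) - twoStepLabel a b i| = a ∨
      |twoStepLabel a b (i + 1) - twoStepLabel a b i| = b := by
  rcases lt_trichotomy i b with h | rfl | h
  · left
    rw [twoStepLabel, twoStepLabel, if_pos (by omega), if_pos h.le]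
    push_cast
    rw [show ((i : ℤ) + 1) * a - i * a = a by ring, Nat.abs_cast]
  · right
    rw [twoStepLabel, twoStepLabel, if_neg (by omega), if_pos le_rfl]
    push_cast
    rw [show ((a : ℤ) + i - (i + 1)) * i - i * a = -i by ring, abs_neg, Nat.abs_cast]
  · right
    rw [twoStepLabel, twoStepLabel, if_neg (by omega), if_neg (by omega)]
    push_cast
    rw [show ((a : ℤ) + b - (i + 1)) * b - (a + b - i) * b = -b by ring, abs_neg, Nat.abs_cast]

theorem twoStepLabel_zero (a b : ℕ) : twoStepLabel a b 0 = 0 := by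
  simp [twoStepLabel]

theorem twoStepLabel_add {a : ℕ} (b : ℕ) (ha : 0 < a) : twoStepLabel a b (a + b) = 0 := by
  rw [twoStepLabel, if_neg (by omega)]
  push_cast
  ring

theorem abs_twoStepLabel_sub_of_sub_val_eq_one {a b : ℕ} (ha : 0 < a) {u v : Fin (a + b)}
    (h : (u - v).val = 1) :
    |twoStepLabel a b u - twoStepLabel a b v| = a ∨
      |twoStepLabel a b u - twoStepLabel a b v| = b := by
  have hu := u.isLt
  have hv := v.isLt
  have key : twoStepLabel a b u = twoStepLabel a b (v + 1) := by
    rcases le_or_gt v u with hvu | huv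
    · rw [Fin.sub_val_of_le hvu] at h
      rw [show (u : ℕ) = v + 1 by omega]
    · have huv' : (u : ℕ) < v := huv
      rw [Fin.val_sub, Nat.mod_eq_of_lt (by omega)] at h
      rw [show (u : ℕ) = 0 by omega, show (v : ℕ) + 1 = a + b by omega, twoStepLabel_zero,
        twoStepLabel_add b ha]
  rw [key]
  exact abs_twoStepLabel_sub_succ a b v

/-- For every `k ≥ 1` there exists an odd `N ≥ 3` such that `C_N` is a strict prime
`k`th-power distance graph. -/
theorem exists_oddCycle_strictPrimePower (k : ℕ) (hk : 1 ≤ k) :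
    ∃ N : ℕ, Odd N ∧ 3 ≤ N ∧
      ∃ L : Fin N → ℤ, IsStrictPrimePowerLabeling (SimpleGraph.cycleGraph N) k L := by
  have h2 : 0 < 2 ^ k := by positivity
  have h3 : 3 ^ 1 ≤ 3 ^ k := Nat.pow_le_pow_right (by norm_num) hk
  have hstep : ∀ u v : Fin (2 ^ k + 3 ^ k), (u - v).val = 1 →
      ∃ p : ℕ, p.Prime ∧
        |twoStepLabel (2 ^ k) (3 ^ k) u - twoStepLabel (2 ^ k) (3 ^ k) v| = (p : ℤ) ^ k := by
    intro u v h
    rcases abs_twoStepLabel_sub_of_sub_val_eq_one h2 h with h | h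
    · exact ⟨2, Nat.prime_two, by rw [h]; push_cast; rfl⟩
    · exact ⟨3, Nat.prime_three, by rw [h]; push_cast; rfl⟩
  refine ⟨2 ^ k + 3 ^ k, ?_, by omega, fun i => twoStepLabel (2 ^ k) (3 ^ k) i, ?_, ?_⟩
  · exact ((even_two : Even 2).pow_of_ne_zero (by omega)).add_odd (Odd.pow (by decide))
  · intro i j h
    exact Fin.ext (twoStepLabel_injOn h2 (by positivity)
      (Nat.Coprime.pow k k (by norm_num)) i.isLt j.isLt h)
  · intro u v h
    rcases SimpleGraph.cycleGraph_adj'.mp h with h | h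
    · exact hstep u v h
    · simp only [abs_sub_comm (twoStepLabel _ _ u)]
      exact hstep v u h
end

section
/- For every integer n ≥ 7, the cycle C_n is a strict prime 2nd-power distance graph; that is, C_n admits an injective labeling of its vertices by integers in which every edge difference is the square of a prime. -/
/-- A cyclic sequence of `n` distinct integers whose consecutive differences are `k`th powers
of primes labels the cycle graph. -/
theorem isStrictPrimePowerLabeling_cycleGraph {n k : ℕ} (hn : 2 ≤ n) (f : ℕ → ℤ)
    (hinj : ∀ i j : ℕ, i < j → j < n → f i ≠ f j)
    (hstep : ∀ i : ℕ, i + 1 < n → ∃ p : ℕ, p.Prime ∧ |f (i + 1) - f i| = (p : ℤ) ^ k)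
    (hlast : ∃ p : ℕ, p.Prime ∧ |f 0 - f (n - 1)| = (p : ℤ) ^ k) :
    IsStrictPrimePowerLabeling (SimpleGraph.cycleGraph n) k (fun i : Fin n => f i) := by
  have key : ∀ u v : Fin n, (u - v).val = 1 →
      ∃ p : ℕ, p.Prime ∧ |f u - f v| = (p : ℤ) ^ k := by
    intro u v h
    have hu := u.isLt
    have hv := v.isLt
    rcases le_or_gt v u with hle | hlt
    · rw [Fin.sub_val_of_le hle] at h
      have huv : u.val = v.val + 1 := by omega
      rw [huv]
      exact hstep v (by omega)
    · rw [Fin.coe_sub_iff_lt.2 hlt] at h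
      have h0 : u.val = 0 := by omega
      have h1 : v.val = n - 1 := by omega
      rw [h0, h1]
      exact hlast
  refine ⟨fun u v h => ?_, fun u v h => ?_⟩
  · rcases lt_trichotomy u v with hlt | heq | hlt
    · exact absurd h (hinj u v hlt v.isLt)
    · exact heq
    · exact absurd h.symm (hinj v u hlt u.isLt)
  · rcases SimpleGraph.cycleGraph_adj'.1 h with h | h
    · exact key u v h
    · simpa only [abs_sub_comm] using key v u h

/-- Up a rail of multiples of `4`, across by `9`, and back down a parallel rail:
a cyclic sequence of length `2 * j + 2`. -/
def evenCycleLabel (j i : ℕ) : ℤ :=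
  if i ≤ j then 4 * i else 9 + 4 * (2 * j + 1 - i)

/-- The cyclic sequence `9, 18, 27, 36, 45, -4, 0` with the step from `9` to `18` replaced by
two parallel descending rails: a cyclic sequence of length `2 * j + 7`. -/
def oddCycleLabel (j i : ℕ) : ℤ :=
  if i ≤ j then 9 - 4 * i
  else if i ≤ 2 * j + 1 then 14 - 8 * j + 4 * i
  else if i = 2 * j + 2 then 27
  else if i = 2 * j + 3 then 36
  else if i = 2 * j + 4 then 45
  else if i = 2 * j + 5 then -4
  else 0

theorem exists_prime_abs_eq_sq {x : ℤ}
    (h : x = 4 ∨ x = -4 ∨ x = 9 ∨ x = -9 ∨ x = 49 ∨ x = -49) :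
    ∃ p : ℕ, p.Prime ∧ |x| = (p : ℤ) ^ 2 := by
  rcases h with rfl | rfl | rfl | rfl | rfl | rfl
  · exact ⟨2, by norm_num⟩
  · exact ⟨2, by norm_num⟩
  · exact ⟨3, by norm_num⟩
  · exact ⟨3, by norm_num⟩
  · exact ⟨7, by norm_num⟩
  · exact ⟨7, by norm_num⟩

/-- For every `n ≥ 7`, the cycle `C_n` is a strict prime 2nd-power distance graph. -/
theorem cycle_strictPrimeSquare (n : ℕ) (hn : 7 ≤ n) :
    ∃ L : Fin n → ℤ, IsStrictPrimePowerLabeling (SimpleGraph.cycleGraph n) 2 L := by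
  rcases Nat.even_or_odd' n with ⟨m, rfl | rfl⟩
  · obtain ⟨j, rfl⟩ : ∃ j, m = j + 1 := ⟨m - 1, by omega⟩
    refine ⟨_, isStrictPrimePowerLabeling_cycleGraph ?_ (evenCycleLabel j) ?_ ?_ ?_⟩
    · omega
    · intro a b hab hb
      unfold evenCycleLabel
      split_ifs <;> omega
    · intro i hi
      apply exists_prime_abs_eq_sq
      unfold evenCycleLabel
      split_ifs <;> omega
    · apply exists_prime_abs_eq_sq
      unfold evenCycleLabel
      split_ifs <;> omega
  · obtain ⟨j, rfl⟩ : ∃ j, m = j + 3 := ⟨m - 3, by omega⟩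
    refine ⟨_, isStrictPrimePowerLabeling_cycleGraph ?_ (oddCycleLabel j) ?_ ?_ ?_⟩
    · omega
    · intro a b hab hb
      unfold oddCycleLabel
      split_ifs <;> omega
    · intro i hi
      apply exists_prime_abs_eq_sq
      unfold oddCycleLabel
      split_ifs <;> omega
    · apply exists_prime_abs_eq_sq
      have hlast : oddCycleLabel j (2 * (j + 3) + 1 - 1) = 0 := by
        unfold oddCycleLabel
        split_ifs <;> omega
      rw [hlast]
      simp [oddCycleLabel]
end
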